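/- Let d : ℕ and let E = EuclideanSpace ℝ (Fin d). Let M̄, Λ : E →L[ℝ] E be symmetric continuous linear maps with ⟪x, Λ x⟫ ≥ λΛ·‖x‖² for all x ∈ E, where λΛ > 0. Let ν > 0 and σm ≥ 0. Let s : ℝ → E and σ̂ : ℝ → ℝ be differentiable, and σ : ℝ → E satisfy ‖σ(t)‖ ≤ σm for all t. Assume for all t: M̄ (s'(t)) = -Λ (s(t)) + σ(t) - σ̂(t) • u(s(t)) and σ̂'(t) = ‖s(t)‖ - ν·σ̂(t). Then the function V(t) = (1/2)·⟪s(t), M̄ (s(t))⟫ + (1/2)·(σ̂(t) - σm)² is differentiable and satisfies V'(t) ≤ -λΛ·‖s(t)‖² - (ν/2)·(σ̂(t) - σm)² + (ν/2)·σm² for all t. -/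

import Mathlib

open RealInnerProductSpace

-- Unit-direction map: `u s = s / ‖s‖` if `s ≠ 0`, and `0` otherwise.
open scoped Classical in
noncomputable def udir {d : ℕ} (s : EuclideanSpace ℝ (Fin d)) : EuclideanSpace ℝ (Fin d) :=
  if s = 0 then 0 else ‖s‖⁻¹ • s


theorem inner_udir_self {d : ℕ} (s : EuclideanSpace ℝ (Fin d)) : ⟪s, udir s⟫ = ‖s‖ := by
  unfold udir
  split_ifs with h
  · simp [h]
  · have h' : ‖s‖ ≠ 0 := norm_ne_zero_iff.mpr h
    rw [real_inner_smul_right, real_inner_self_eq_norm_sq]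
    field_simp

/-- Lyapunov dissipation inequality: `V = (1/2)⟪s, M̄ s⟫ + (1/2)(σ̂ - σm)²`
is differentiable and `V' ≤ -λΛ‖s‖² - (ν/2)(σ̂ - σm)² + (ν/2)σm²`. -/
theorem stmt4 {d : ℕ}
    (Mbar Lam : EuclideanSpace ℝ (Fin d) →L[ℝ] EuclideanSpace ℝ (Fin d))
    (hMsym : ∀ x y : EuclideanSpace ℝ (Fin d), ⟪Mbar x, y⟫ = ⟪x, Mbar y⟫)
    (hLsym : ∀ x y : EuclideanSpace ℝ (Fin d), ⟪Lam x, y⟫ = ⟪x, Lam y⟫)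
    (lamL : ℝ) (hlamL : 0 < lamL)
    (hLam : ∀ x : EuclideanSpace ℝ (Fin d), lamL * ‖x‖ ^ 2 ≤ ⟪x, Lam x⟫)
    (ν σm : ℝ) (hν : 0 < ν) (hσm : 0 ≤ σm)
    (s s' : ℝ → EuclideanSpace ℝ (Fin d)) (sighat sighat' : ℝ → ℝ)
    (hs : ∀ t, HasDerivAt s (s' t) t)
    (hsighat : ∀ t, HasDerivAt sighat (sighat' t) t)
    (σ : ℝ → EuclideanSpace ℝ (Fin d)) (hσ : ∀ t, ‖σ t‖ ≤ σm)
    (hdyn : ∀ t, Mbar (s' t) = -Lam (s t) + σ t - sighat t • udir (s t))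
    (hadapt : ∀ t, sighat' t = ‖s t‖ - ν * sighat t)
    (V : ℝ → ℝ)
    (hV : V = fun t => (1 / 2) * ⟪s t, Mbar (s t)⟫ + (1 / 2) * (sighat t - σm) ^ 2) :
    (∀ t, DifferentiableAt ℝ V t) ∧
    ∀ t, deriv V t ≤
      -lamL * ‖s t‖ ^ 2 - (ν / 2) * (sighat t - σm) ^ 2 + (ν / 2) * σm ^ 2 := by
  have hderiv : ∀ t, HasDerivAt V
      (⟪s t, Mbar (s' t)⟫ + (sighat t - σm) * sighat' t) t := by
    intro t
    have h1 := (hs t).inner ℝ (Mbar.hasFDerivAt.comp_hasDerivAt t (hs t))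
    have h2 := ((hsighat t).sub_const σm).pow 2
    have h3 := (h1.const_mul (1 / 2 : ℝ)).add (h2.const_mul (1 / 2 : ℝ))
    rw [hV]
    refine h3.congr_deriv ?_
    have h4 : ⟪s' t, Mbar (s t)⟫ = ⟪s t, Mbar (s' t)⟫ := by
      rw [← hMsym, real_inner_comm]
    simp only [Function.comp_apply, h4]
    push_cast
    ring
  refine ⟨fun t => (hderiv t).differentiableAt, fun t => ?_⟩
  rw [(hderiv t).deriv, hdyn, hadapt, inner_sub_right, inner_add_right, inner_neg_right,
    real_inner_smul_right, inner_udir_self]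
  have hcross : ⟪s t, σ t⟫ ≤ ‖s t‖ * σm :=
    (real_inner_le_norm _ _).trans (mul_le_mul_of_nonneg_left (hσ t) (norm_nonneg _))
  nlinarith [hLam (s t), mul_nonneg hν.le (sq_nonneg (sighat t))]
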